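/- Let H = diag(H₁, …, H_N) ∈ ℝ^{dN×dN} be block diagonal with each H_i ∈ ℝ^{d×d} symmetric and satisfying ξI_d ≤ H_i ≤ LI_d for reals 0 < ξ ≤ L, and let 0 < α < 1/(2L). Let ℳ ∈ ℝ^{dN×dN} be symmetric stochastic (as an dN×dN matrix) with every diagonal entry at least 1/2 and ℳ ≠ I_{dN}. Assume: (i) every x ∈ ℝ^{dN} with ℳx = x has the consensus form x = 1_N ⊗ v for some v ∈ ℝ^d (i.e. all N blocks of x are equal); and (ii) there is no nonzero v ∈ ℝ^d with H_i v = λmin(H)·v for every i = 1, …, N. Then the spectral radii satisfy the strict inequality ρ(ℳ − αH) < ρ(I_{dN} − αH). -/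

import Mathlib

open Matrix

/-- The smallest eigenvalue `λmin` of a real symmetric (Hermitian) matrix. -/
noncomputable def eigMin {m : Type*} [Fintype m] [DecidableEq m]
    {A : Matrix m m ℝ} (hA : A.IsHermitian) : ℝ :=
  ⨅ i, hA.eigenvalues i

/-- The spectral radius `ρ(A) = max {|λ| : λ eigenvalue of A}` of a real symmetric
(Hermitian) matrix. -/
noncomputable def specRad {m : Type*} [Fintype m] [DecidableEq m]
    {A : Matrix m m ℝ} (hA : A.IsHermitian) : ℝ :=
  ⨆ i, |hA.eigenvalues i|


lemma aux_mem_eig {m : Type*} [Fintype m] [DecidableEq m] {A : Matrix m m ℝ}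
    (hA : A.IsHermitian) (x : m → ℝ) (hx : x ≠ 0) (μ : ℝ) (h : A.mulVec x = μ • x) :
    ∃ i, hA.eigenvalues i = μ := by
  have h1 : Module.End.HasEigenvalue (Matrix.toLin' A) μ := by
    apply Module.End.hasEigenvalue_of_hasEigenvector (x := x)
    rw [Module.End.hasEigenvector_iff, Module.End.mem_eigenspace_iff]
    exact ⟨by simpa using h, hx⟩
  have h2 := h1.mem_spectrum
  rw [Matrix.spectrum_toLin', hA.spectrum_real_eq_range_eigenvalues] at h2
  exact h2

lemma aux_eigvec {m : Type*} [Fintype m] [DecidableEq m] {A : Matrix m m ℝ}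
    (hA : A.IsHermitian) (i : m) :
    ∃ x : m → ℝ, x ≠ 0 ∧ A.mulVec x = hA.eigenvalues i • x := by
  refine ⟨WithLp.ofLp (hA.eigenvectorBasis i), ?_, hA.mulVec_eigenvectorBasis i⟩
  intro h
  apply hA.eigenvectorBasis.orthonormal.ne_zero i
  ext j
  exact congrFun h j

lemma aux_stoch {m : Type*} [Fintype m] {B : Matrix m m ℝ}
    (hs : ∀ p q, B p q = B q p) (hn : ∀ p q, 0 ≤ B p q) (hr : ∀ p, ∑ q, B p q = 1)
    (x : m → ℝ) : x ⬝ᵥ B.mulVec x ≤ x ⬝ᵥ x ∧ -(x ⬝ᵥ x) ≤ x ⬝ᵥ B.mulVec x := by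
  have e1 : x ⬝ᵥ B.mulVec x = ∑ p, ∑ q, B p q * (x p * x q) := by
    simp only [dotProduct, Matrix.mulVec, Finset.mul_sum]
    refine Finset.sum_congr rfl fun p _ => Finset.sum_congr rfl fun q _ => by ring
  have e2 : x ⬝ᵥ x = ∑ p, ∑ q, B p q * (x p * x p) := by
    simp only [dotProduct, ← Finset.sum_mul, hr, one_mul]
  have e3 : x ⬝ᵥ x = ∑ p, ∑ q, B p q * (x q * x q) := by
    rw [e2, Finset.sum_comm]
    refine Finset.sum_congr rfl fun p _ => Finset.sum_congr rfl fun q _ => by rw [hs]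
  have p1 : 0 ≤ ∑ p, ∑ q, B p q * (x p - x q) ^ 2 :=
    Finset.sum_nonneg fun p _ => Finset.sum_nonneg fun q _ => mul_nonneg (hn p q) (sq_nonneg _)
  have p2 : 0 ≤ ∑ p, ∑ q, B p q * (x p + x q) ^ 2 :=
    Finset.sum_nonneg fun p _ => Finset.sum_nonneg fun q _ => mul_nonneg (hn p q) (sq_nonneg _)
  have q1 : ∑ p, ∑ q, B p q * (x p - x q) ^ 2
      = x ⬝ᵥ x + x ⬝ᵥ x - 2 * (x ⬝ᵥ B.mulVec x) := by
    nth_rewrite 1 [e2]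
    rw [e3, e1]
    simp only [Finset.mul_sum, ← Finset.sum_add_distrib, ← Finset.sum_sub_distrib]
    refine Finset.sum_congr rfl fun p _ => Finset.sum_congr rfl fun q _ => by ring
  have q2 : ∑ p, ∑ q, B p q * (x p + x q) ^ 2
      = x ⬝ᵥ x + x ⬝ᵥ x + 2 * (x ⬝ᵥ B.mulVec x) := by
    nth_rewrite 1 [e2]
    rw [e3, e1]
    simp only [Finset.mul_sum, ← Finset.sum_add_distrib]
    refine Finset.sum_congr rfl fun p _ => Finset.sum_congr rfl fun q _ => by ring
  constructor <;> linarith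

lemma aux_pos {m : Type*} [Fintype m] (x : m → ℝ) (hx : x ≠ 0) : 0 < x ⬝ᵥ x := by
  have h0 : 0 ≤ x ⬝ᵥ x := Finset.sum_nonneg fun i _ => mul_self_nonneg _
  exact lt_of_le_of_ne h0 fun h => hx (dotProduct_self_eq_zero.1 h.symm)

/-- Let `H = diag(H₁, …, H_N)` be block diagonal with each `Hᵢ` symmetric
and `ξI ≤ Hᵢ ≤ LI` where `0 < ξ ≤ L`, let `0 < α < 1/(2L)`, and let `ℳ` be a symmetric
stochastic `dN × dN` matrix with all diagonal entries at least `1/2` and `ℳ ≠ I`. If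
(i) every fixed vector of `ℳ` has consensus form (all `N` blocks equal), and (ii) there is no
nonzero `v ∈ ℝ^d` with `Hᵢ v = λmin(H)·v` for every `i`, then
`ρ(ℳ − αH) < ρ(I − αH)`. -/
theorem specRad_transfer_lt_specRad_no_transfer {d N : ℕ} (hd : 0 < d) (hN : 0 < N)
    (Hblk : Fin N → Matrix (Fin d) (Fin d) ℝ)
    (hHblk : ∀ i, (Hblk i).IsHermitian)
    (ξ L : ℝ) (hξ : 0 < ξ) (hξL : ξ ≤ L)
    (hbound : ∀ i (v : Fin d → ℝ),
      ξ * (v ⬝ᵥ v) ≤ v ⬝ᵥ (Hblk i).mulVec v ∧ v ⬝ᵥ (Hblk i).mulVec v ≤ L * (v ⬝ᵥ v))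
    (α : ℝ) (hα : 0 < α) (hα2 : α < 1 / (2 * L))
    (H : Matrix (Fin N × Fin d) (Fin N × Fin d) ℝ)
    (hHdef : H = Matrix.of fun p q => if p.1 = q.1 then Hblk p.1 p.2 q.2 else 0)
    (hH : H.IsHermitian)
    (ℳ : Matrix (Fin N × Fin d) (Fin N × Fin d) ℝ)
    (hℳherm : ℳ.IsHermitian)
    (hℳnonneg : ∀ p q, 0 ≤ ℳ p q)
    (hℳrow : ∀ p, ∑ q, ℳ p q = 1)
    (hℳdiag : ∀ p, (1 : ℝ) / 2 ≤ ℳ p p)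
    (hℳne : ℳ ≠ 1)
    (hconsensus : ∀ x : Fin N × Fin d → ℝ, ℳ.mulVec x = x →
      ∃ v : Fin d → ℝ, ∀ p, x p = v p.2)
    (hno : ¬ ∃ v : Fin d → ℝ, v ≠ 0 ∧ ∀ i, (Hblk i).mulVec v = eigMin hH • v)
    (hAm : (ℳ - α • H).IsHermitian)
    (hAs : ((1 : Matrix (Fin N × Fin d) (Fin N × Fin d) ℝ) - α • H).IsHermitian) :
    specRad hAm < specRad hAs := by
  have hL : 0 < L := lt_of_lt_of_le hξ hξL
  have hαL : α * L < 1 / 2 := by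
    rw [lt_div_iff₀ (by positivity)] at hα2
    linarith
  haveI : Nonempty (Fin N × Fin d) := ⟨(⟨0, hN⟩, ⟨0, hd⟩)⟩
  have hHv : ∀ (x : Fin N × Fin d → ℝ) (i : Fin N) (j : Fin d),
      H.mulVec x (i, j) = (Hblk i).mulVec (fun k => x (i, k)) j := by
    intro x i j
    subst hHdef
    simp [Matrix.mulVec, dotProduct, Fintype.sum_prod_type]
  have hHL : ∀ x : Fin N × Fin d → ℝ, x ⬝ᵥ H.mulVec x ≤ L * (x ⬝ᵥ x) := by
    intro x
    have := Finset.sum_le_sum fun i (_ : i ∈ Finset.univ) =>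
      (hbound i (fun k => x (i, k))).2
    rw [← Finset.mul_sum] at this
    simpa only [dotProduct, Fintype.sum_prod_type, hHv] using this
  set c := eigMin hH with hc
  obtain ⟨i0, hi0⟩ : ∃ i, hH.eigenvalues i = c := exists_eq_ciInf_of_finite
  have hcle : ∀ i, c ≤ hH.eigenvalues i := fun i => ciInf_le (Set.finite_range _).bddBelow i
  obtain ⟨y, hy0, hy⟩ := aux_eigvec hH i0
  rw [hi0] at hy
  have hcL : c ≤ L := by
    have h1 := hHL y
    rw [hy, dotProduct_smul, smul_eq_mul] at h1
    exact le_of_mul_le_mul_right h1 (aux_pos y hy0)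
  have hαc : α * c ≤ α * L := mul_le_mul_of_nonneg_left hcL hα.le
  -- lower bound on the right-hand side
  have hR : 1 - α * c ≤ specRad hAs := by
    obtain ⟨i, hi⟩ := aux_mem_eig hAs y hy0 (1 - α * c) (by
      rw [Matrix.sub_mulVec, Matrix.one_mulVec, Matrix.smul_mulVec, hy, sub_smul, one_smul,
        smul_smul])
    calc 1 - α * c ≤ |hAs.eigenvalues i| := by rw [hi]; exact le_abs_self _
      _ ≤ specRad hAs := le_ciSup (f := fun i => |hAs.eigenvalues i|)
          (Set.finite_range _).bddAbove i
  refine lt_of_lt_of_le ?_ hR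
  -- PSD facts
  have hPH : (H - c • (1 : Matrix (Fin N × Fin d) (Fin N × Fin d) ℝ)).PosSemidef := by
    have hh : (H - c • (1 : Matrix (Fin N × Fin d) (Fin N × Fin d) ℝ)).IsHermitian := by
      refine hH.sub ?_
      simp [Matrix.IsHermitian]
    rw [hh.posSemidef_iff_eigenvalues_nonneg]
    intro i
    obtain ⟨z, hz0, hz⟩ := aux_eigvec hh i
    rw [Matrix.sub_mulVec, Matrix.smul_mulVec, Matrix.one_mulVec, sub_eq_iff_eq_add,
      ← add_smul] at hz
    obtain ⟨j, hj⟩ := aux_mem_eig hH z hz0 _ hz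
    have := hcle j
    simp only [Pi.zero_apply]
    linarith
  have hsym : ∀ p q, ℳ p q = ℳ q p := fun p q => by
    have := hℳherm.apply q p
    simpa using this
  have hPM : (1 - ℳ).PosSemidef := by
    refine Matrix.PosSemidef.of_dotProduct_mulVec_nonneg (Matrix.isHermitian_one.sub hℳherm) ?_
    intro x
    have := (aux_stoch hsym hℳnonneg hℳrow x).1
    simp only [star_trivial, Matrix.sub_mulVec, Matrix.one_mulVec, dotProduct_sub]
    linarith
  have hM0 : ∀ x : Fin N × Fin d → ℝ, 0 ≤ x ⬝ᵥ ℳ.mulVec x := by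
    intro x
    have := (aux_stoch (B := (2 : ℝ) • ℳ - 1) ?_ ?_ ?_ x).2
    · rw [Matrix.sub_mulVec, Matrix.one_mulVec, Matrix.smul_mulVec, dotProduct_sub,
        dotProduct_smul, smul_eq_mul] at this
      linarith
    · intro p q
      simp [hsym p q, Matrix.one_apply, eq_comm]
    · intro p q
      by_cases hpq : p = q
      · subst hpq
        have := hℳdiag p
        simp
        linarith
      · have := hℳnonneg p q
        simp [hpq, this]
    · intro p
      simp [Finset.sum_sub_distrib, ← Finset.mul_sum, hℳrow, Matrix.one_apply]
      norm_num
  -- bound each eigenvalue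
  obtain ⟨k, hk⟩ : ∃ i, |hAm.eigenvalues i| = specRad hAm := exists_eq_ciSup_of_finite
  rw [← hk]
  obtain ⟨x, hx0, hx⟩ := aux_eigvec hAm k
  set μ := hAm.eigenvalues k
  have hxp := aux_pos x hx0
  have hray : x ⬝ᵥ ℳ.mulVec x - α * (x ⬝ᵥ H.mulVec x) = μ * (x ⬝ᵥ x) := by
    have := congrArg (fun z => x ⬝ᵥ z) hx
    simpa [Matrix.sub_mulVec, Matrix.smul_mulVec, dotProduct_sub, dotProduct_smul] using this
  have f1 := hPH.dotProduct_mulVec_nonneg x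
  have f2 := hPM.dotProduct_mulVec_nonneg x
  have g1 := (hPH.dotProduct_mulVec_zero_iff x).1
  have g2 := (hPM.dotProduct_mulVec_zero_iff x).1
  simp only [star_trivial, Matrix.sub_mulVec, Matrix.one_mulVec, Matrix.smul_mulVec,
    dotProduct_sub, dotProduct_smul, smul_eq_mul] at f1 f2 g1 g2
  have f1' := mul_nonneg hα.le f1
  rw [abs_lt]
  constructor
  · have h1 := hHL x
    have h2 := hM0 x
    have h3 := mul_le_mul_of_nonneg_left h1 hα.le
    have h4 : -(α * L) * (x ⬝ᵥ x) ≤ μ * (x ⬝ᵥ x) := by linarith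
    have h5 := le_of_mul_le_mul_right h4 hxp
    linarith
  · by_contra hcon
    push Not at hcon
    have h1 := mul_le_mul_of_nonneg_right hcon hxp.le
    have z2 : x ⬝ᵥ x - x ⬝ᵥ ℳ.mulVec x = 0 := by linarith
    have z1' : α * (x ⬝ᵥ H.mulVec x - c * (x ⬝ᵥ x)) = 0 := by linarith
    have z1 := (mul_eq_zero.1 z1').resolve_left hα.ne'
    have r1 := sub_eq_zero.1 (g1 z1)
    have r2 := sub_eq_zero.1 (g2 z2)
    obtain ⟨v, hv⟩ := hconsensus x r2.symm
    apply hno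
    refine ⟨v, ?_, ?_⟩
    · rintro rfl
      apply hx0
      ext p
      simp [hv]
    · intro i
      ext j
      have := congrFun r1 (i, j)
      rw [hHv] at this
      simpa [hv] using this
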